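/- Let p be a prime, a, b integers with 1 ≤ b ≤ a and a ≡ b (mod p−1), and d ≥ 1 an integer. Then, in ℚ_p, the limit as e → ∞ of S(p^e·a + d − 1, p^e·b + d) equals T_p(d−1, d) times the limit as e → ∞ of C(p^e·(pa−b)/(p−1) − 1, p^e·b) (both limits exist in ℤ_p ⊆ ℚ_p, and the rational number T_p(d−1,d) is viewed in ℚ_p). -/

import Mathlib

/-- Stirling numbers of the second kind for integer arguments:
`S(n,k) = (1/k!) ∑_{i=0}^{k} (-1)^(k-i) C(k,i) i^n` for `n, k ≥ 0` (with `0^0 = 1`),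
and `S(n,k) = 0` if `n < 0` or `k < 0`. -/
def stirling2 (n k : ℤ) : ℤ :=
  if n < 0 ∨ k < 0 then 0
  else (∑ i ∈ Finset.range (k.toNat + 1),
      (-1 : ℤ) ^ (k.toNat - i) * (Nat.choose k.toNat i : ℤ) * (i : ℤ) ^ n.toNat)
    / (Nat.factorial k.toNat : ℤ)

/-- Binomial coefficient for (nonnegative) integer arguments. -/
def ichoose (n k : ℤ) : ℤ := (Nat.choose n.toNat k.toNat : ℤ)

/-- Partial Stirling numbers
`T_p(n,k) = ((-1)^k/k!) ∑_{0 ≤ i ≤ k, p ∤ i} (-1)^i C(k,i) i^n`. -/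
def partialStirling (p : ℕ) (n k : ℕ) : ℚ :=
  ((-1 : ℚ) ^ k / (Nat.factorial k : ℚ)) *
    ∑ i ∈ Finset.range (k + 1),
      if ¬ (p ∣ i) then (-1 : ℚ) ^ i * (Nat.choose k i : ℚ) * (i : ℚ) ^ n else 0

section

open Finset

theorem sum_choose_pow_eq_factorial_mul_stirlingSecond (n k : ℕ) :
    ∑ i ∈ range (k + 1), (-1 : ℤ) ^ (k - i) * (k.choose i : ℤ) * (i : ℤ) ^ n =
      (k.factorial : ℤ) * (n.stirlingSecond k : ℤ) := by
  have alt (k : ℕ) : ∑ i ∈ range (k + 1), (-1 : ℤ) ^ (k - i) * (k.choose i : ℤ) =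
      if k = 0 then 1 else 0 := by
    have h := add_pow (1 : ℤ) (-1) k
    simp only [one_pow, one_mul, add_neg_cancel, zero_pow_eq] at h
    rw [h]
  induction n generalizing k with
  | zero =>
    simp only [pow_zero, mul_one, alt]
    cases k <;> simp
  | succ n ih =>
    cases k with
    | zero => simp
    | succ k =>
      have absorb : ∑ i ∈ range (k + 1 + 1),
          (-1 : ℤ) ^ (k + 1 - i) * ((k + 1).choose i : ℤ) * (i : ℤ) ^ (n + 1) =
          (k + 1) * ∑ i ∈ range (k + 1),
            (-1 : ℤ) ^ (k - i) * (k.choose i : ℤ) * ((i + 1 : ℕ) : ℤ) ^ n := by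
        rw [sum_range_succ', mul_sum]
        simp only [Nat.cast_zero, ne_eq, Nat.add_eq_zero_iff, one_ne_zero, and_false,
          not_false_eq_true, zero_pow, mul_zero, add_zero]
        refine sum_congr rfl fun i _ => ?_
        have h : ((k : ℤ) + 1) * (k.choose i : ℤ) = ((k + 1).choose (i + 1) : ℤ) * ((i : ℤ) + 1) := by
          exact_mod_cast Nat.add_one_mul_choose_eq k i
        rw [Nat.add_sub_add_right, pow_succ]
        push_cast
        linear_combination (-(-1 : ℤ) ^ (k - i) * ((i : ℤ) + 1) ^ n) * h
      have pascal : ∑ i ∈ range (k + 1 + 1),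
          (-1 : ℤ) ^ (k + 1 - i) * ((k + 1).choose i : ℤ) * (i : ℤ) ^ n =
          ∑ i ∈ range (k + 1), (-1 : ℤ) ^ (k - i) * (k.choose i : ℤ) * ((i + 1 : ℕ) : ℤ) ^ n -
          ∑ i ∈ range (k + 1), (-1 : ℤ) ^ (k - i) * (k.choose i : ℤ) * (i : ℤ) ^ n := by
        have h2 : ∑ i ∈ range (k + 1), (-1 : ℤ) ^ (k - i) * (k.choose i : ℤ) * (i : ℤ) ^ n =
            -∑ i ∈ range (k + 1 + 1),
              (-1 : ℤ) ^ (k + 1 - i) * (k.choose i : ℤ) * (i : ℤ) ^ n := by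
          rw [sum_range_succ _ (k + 1), Nat.choose_succ_self, Nat.cast_zero, mul_zero, zero_mul,
            add_zero, ← sum_neg_distrib]
          refine sum_congr rfl fun i hi => ?_
          rw [Nat.sub_add_comm (Nat.le_of_lt_succ (mem_range.1 hi)), pow_succ]
          ring
        rw [h2, sum_range_succ', sum_range_succ' _ (k + 1), sub_neg_eq_add, ← add_assoc,
          ← sum_add_distrib]
        congr 1
        · refine sum_congr rfl fun i _ => ?_
          rw [Nat.choose_succ_succ, Nat.add_sub_add_right]
          push_cast
          ring
        · simp
      rw [absorb, Nat.stirlingSecond_succ_succ, Nat.factorial_succ]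
      have h1 := ih (k + 1)
      rw [pascal, ih k, Nat.factorial_succ] at h1
      push_cast at h1 ⊢
      linear_combination ((k : ℤ) + 1) * h1

theorem stirling2_natCast (n k : ℕ) : stirling2 n k = (n.stirlingSecond k : ℤ) := by
  have h : ¬((n : ℤ) < 0 ∨ (k : ℤ) < 0) := by omega
  rw [stirling2, if_neg h]
  simp only [Int.toNat_natCast]
  rw [sum_choose_pow_eq_factorial_mul_stirlingSecond]
  exact Int.mul_ediv_cancel_left _ (by exact_mod_cast k.factorial_ne_zero)

/-- The polynomial `∏_{j=1}^{m} (1 - jX)`. -/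
noncomputable def prodOneSubMulX (R : Type*) [CommRing R] (m : ℕ) : Polynomial R :=
  ∏ j ∈ range m, (1 - Polynomial.C ((j + 1 : ℕ) : R) * Polynomial.X)

theorem map_prodOneSubMulX {R S : Type*} [CommRing R] [CommRing S] (f : R →+* S) (m : ℕ) :
    (prodOneSubMulX R m).map f = prodOneSubMulX S m := by
  simp [prodOneSubMulX, Polynomial.map_prod]

theorem prodOneSubMulX_mul_add {R : Type*} [CommRing R] {n : ℕ} (hn : (n : R) = 0) (t d : ℕ) :
    prodOneSubMulX R (n * t + d) = prodOneSubMulX R n ^ t * prodOneSubMulX R d := by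
  induction t with
  | zero => simp
  | succ t ih =>
    rw [Nat.mul_succ, show n * t + n + d = n + (n * t + d) by ring, pow_succ', mul_assoc, ← ih]
    simp only [prodOneSubMulX, prod_range_add _ n (n * t + d)]
    congr 1
    refine prod_congr rfl fun j _ => ?_
    push_cast
    rw [hn, zero_add]

theorem mk_stirlingSecond_mul_prodOneSubMulX (R : Type*) [CommRing R] (k : ℕ) :
    PowerSeries.mk (fun n => ((n + k).stirlingSecond k : R)) * (prodOneSubMulX R k : PowerSeries R)
      = 1 := by
  induction k with
  | zero =>
    ext n
    cases n <;> simp [prodOneSubMulX, PowerSeries.coeff_one]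
  | succ k ih =>
    rw [prodOneSubMulX, prod_range_succ, ← prodOneSubMulX, mul_comm (prodOneSubMulX R k),
      Polynomial.coe_mul, ← mul_assoc]
    suffices h : PowerSeries.mk (fun n => ((n + (k + 1)).stirlingSecond (k + 1) : R)) *
        ((1 - Polynomial.C ((k + 1 : ℕ) : R) * Polynomial.X : Polynomial R) : PowerSeries R) =
        PowerSeries.mk (fun n => ((n + k).stirlingSecond k : R)) by rw [h, ih]
    simp only [Polynomial.coe_sub, Polynomial.coe_one, Polynomial.coe_mul, Polynomial.coe_C,
      Polynomial.coe_X, mul_sub, mul_one]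
    ext n
    rw [map_sub, mul_left_comm, PowerSeries.coeff_C_mul]
    cases n with
    | zero => simp [Nat.stirlingSecond_self]
    | succ n =>
      rw [PowerSeries.coeff_succ_mul_X]
      simp only [PowerSeries.coeff_mk]
      rw [show n + 1 + (k + 1) = (n + 1 + k) + 1 by ring, Nat.stirlingSecond_succ_succ,
        show n + (k + 1) = n + 1 + k by ring]
      push_cast
      ring

theorem prodOneSubMulX_zmod_prime (p : ℕ) [hp : Fact p.Prime] :
    prodOneSubMulX (ZMod p) p = 1 - Polynomial.X ^ (p - 1) := by
  obtain ⟨m, rfl⟩ : ∃ m, p = m + 1 := ⟨p - 1, (Nat.sub_add_cancel hp.out.one_le).symm⟩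
  have hm : m ≠ 0 := by rintro rfl; exact Nat.not_prime_one hp.out
  rw [prodOneSubMulX, prod_range_succ, CharP.cast_eq_zero, map_zero, zero_mul, sub_zero, mul_one]
  refine Polynomial.eq_of_degree_sub_lt_of_eval_finset_eq univ ?_ fun x _ => ?_
  · rw [card_univ, ZMod.card]
    refine lt_of_le_of_lt (Polynomial.degree_sub_le_of_le (a := m) (b := m) ?_ ?_) ?_
    · refine (Polynomial.degree_prod_le _ _).trans ?_
      refine (sum_le_card_nsmul _ _ 1 fun j _ => ?_).trans (by simp)
      compute_degree
    · rw [Nat.add_sub_cancel]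
      compute_degree
      exact le_rfl
    · simp only [max_self]
      exact_mod_cast Nat.lt_succ_self m
  · simp only [Polynomial.eval_prod, Polynomial.eval_sub, Polynomial.eval_one, Polynomial.eval_mul,
      Polynomial.eval_C, Polynomial.eval_X, Polynomial.eval_pow]
    rcases eq_or_ne x 0 with rfl | hx
    · simp [hm]
    · rw [ZMod.pow_card_sub_one_eq_one hx, sub_self]
      have hv : x⁻¹.val ≠ 0 := by simpa [ZMod.val_eq_zero] using hx
      refine prod_eq_zero (i := x⁻¹.val - 1) ?_ ?_
      · have := ZMod.val_lt x⁻¹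
        simp only [mem_range]; omega
      · rw [Nat.sub_add_cancel (Nat.one_le_iff_ne_zero.2 hv), ZMod.natCast_zmod_val,
          inv_mul_cancel₀ hx, sub_self]

theorem prodOneSubMulX_zmod_prime_pow (p r s t d : ℕ) [hp : Fact p.Prime] (hrs : r ≤ s) :
    prodOneSubMulX (ZMod (p ^ (r + 1))) (p ^ (r + 1 + s) * t + d) =
      (1 - Polynomial.X ^ (p ^ r * (p - 1))) ^ (p ^ s * t) *
        prodOneSubMulX (ZMod (p ^ (r + 1))) d := by
  have hdvd : (p : Polynomial ℤ) ∣
      prodOneSubMulX ℤ (p ^ (r + 1)) - (1 - Polynomial.X ^ (p ^ r * (p - 1))) := by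
    rw [← map_natCast Polynomial.C, Polynomial.C_dvd_iff_dvd_coeff]
    intro i
    rw [← ZMod.intCast_zmod_eq_zero_iff_dvd,
      ← eq_intCast (Int.castRingHom (ZMod p)), ← Polynomial.coeff_map, Polynomial.map_sub,
      map_prodOneSubMulX, pow_succ', ← add_zero (p * p ^ r),
      prodOneSubMulX_mul_add (CharP.cast_eq_zero _ _), prodOneSubMulX_zmod_prime, sub_pow_char_pow]
    simp [prodOneSubMulX, ← pow_mul, mul_comm]
  have hpow := dvd_sub_pow_of_dvd_sub hdvd s
  have hpow' := (pow_dvd_pow (p : Polynomial ℤ) (Nat.succ_le_succ hrs)).trans hpow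
  have hmap := map_dvd (Polynomial.mapRingHom (Int.castRingHom (ZMod (p ^ (r + 1))))) hpow'
  have hz : (p : Polynomial (ZMod (p ^ (r + 1)))) ^ (r + 1) = 0 := by
    rw [← Nat.cast_pow, ← map_natCast Polynomial.C, CharP.cast_eq_zero, map_zero]
  simp only [map_pow, map_natCast, hz, zero_dvd_iff, map_sub, Polynomial.coe_mapRingHom,
    map_prodOneSubMulX, map_one, Polynomial.map_X, sub_eq_zero] at hmap
  rw [pow_add p (r + 1), mul_assoc, prodOneSubMulX_mul_add (CharP.cast_eq_zero _ _), pow_mul, hmap, ← pow_mul]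

theorem coeff_eq_choose_of_mul_one_sub_X_pow {R : Type*} [CommRing R] {q : ℕ} (hq : 0 < q) (D : R)
    (B : ℕ) (F K : PowerSeries R) (hF : F * (1 - PowerSeries.X ^ q) ^ B = K)
    (hK : ∀ m, PowerSeries.coeff (q * (m + 1) - 1) K = D) (m : ℕ) :
    PowerSeries.coeff (q * (m + 1) - 1) F = D * ((B + m).choose B : R) := by
  induction B generalizing F m with
  | zero => simp_all
  | succ B ih =>
    have h := ih (F * (1 - PowerSeries.X ^ q)) (by rw [mul_assoc, ← pow_succ', hF])
    simp only [mul_sub, mul_one, map_sub, PowerSeries.coeff_mul_X_pow'] at h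
    induction m with
    | zero => 
      have := h 0
      rw [if_neg (by omega)] at this
      simpa using this
    | succ m ihm =>
      have h1 := h (m + 1)
      have hle : q ≤ q * (m + 1) := Nat.le_mul_of_pos_right q (Nat.succ_pos m)
      rw [mul_add q (m + 1), mul_one, if_pos (by omega),
        show q * (m + 1) + q - 1 - q = q * (m + 1) - 1 by omega, ihm] at h1
      rw [mul_add q (m + 1), mul_one, sub_eq_iff_eq_add.1 h1,
        show B + 1 + (m + 1) = (B + (m + 1)) + 1 by ring, Nat.choose_succ_succ,
        show B + 1 + m = B + (m + 1) by ring]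
      push_cast
      ring

theorem natCast_pow_zmod_prime_pow (p r m c i : ℕ) [hp : Fact p.Prime] :
    (i : ZMod (p ^ (r + 1))) ^ (p ^ r * (p - 1) * (m + 1) + c) =
      if ¬ p ∣ i then (i : ZMod (p ^ (r + 1))) ^ c else 0 := by
  split_ifs with h
  · obtain ⟨j, rfl⟩ := h
    have hr : r + 1 ≤ p ^ r * (p - 1) * (m + 1) + c := by
      have h1 : r < p ^ r := Nat.lt_pow_self hp.out.one_lt
      have h2 : 1 ≤ p - 1 := Nat.le_sub_one_of_lt hp.out.one_lt
      calc r + 1 ≤ p ^ r := h1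
        _ ≤ p ^ r * (p - 1) := Nat.le_mul_of_pos_right _ h2
        _ ≤ p ^ r * (p - 1) * (m + 1) := Nat.le_mul_of_pos_right _ m.succ_pos
        _ ≤ _ := Nat.le_add_right _ _
    have hz : (p : ZMod (p ^ (r + 1))) ^ (r + 1) = 0 := by
      rw [← Nat.cast_pow, CharP.cast_eq_zero]
    rw [Nat.cast_mul, mul_pow, pow_eq_zero_of_le hr hz, zero_mul]
  · have hco : i.Coprime (p ^ (r + 1)) :=
      Nat.Coprime.pow_right _ ((Nat.Prime.coprime_iff_not_dvd hp.out).2 h).symm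
    have ht := congrArg Units.val (ZMod.pow_totient (ZMod.unitOfCoprime i hco))
    rw [Units.val_pow_eq_pow_val, ZMod.coe_unitOfCoprime, Units.val_one,
      Nat.totient_prime_pow_succ hp.out] at ht
    rw [pow_add (i : ZMod (p ^ (r + 1))), pow_mul (i : ZMod (p ^ (r + 1))), ht, one_pow, one_mul]

/-- The integer `d! · T_p(n, d)`. -/
def factorialMulPartialStirling (p n d : ℕ) : ℤ :=
  ∑ i ∈ range (d + 1), if ¬ p ∣ i then (-1 : ℤ) ^ (d - i) * (d.choose i : ℤ) * (i : ℤ) ^ n else 0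

theorem partialStirling_eq_div (p n d : ℕ) :
    partialStirling p n d = (factorialMulPartialStirling p n d : ℚ) / (d.factorial : ℚ) := by
  rw [partialStirling, factorialMulPartialStirling, div_mul_eq_mul_div, mul_sum, Int.cast_sum]
  congr 1
  refine sum_congr rfl fun i hi => ?_
  split_ifs
  · simp
  · obtain ⟨j, rfl⟩ := Nat.exists_eq_add_of_le (Nat.le_of_lt_succ (mem_range.1 hi))
    rw [Nat.add_sub_cancel_left]
    have hsq : (-1 : ℚ) ^ i * (-1 : ℚ) ^ i = 1 := by rw [← mul_pow]; simp
    push_cast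
    rw [pow_add]
    linear_combination ((-1 : ℚ) ^ j * ((i + j).choose i : ℚ) * (i : ℚ) ^ n) * hsq

theorem factorial_mul_stirlingSecond_zmod (p r m c d : ℕ) [Fact p.Prime] :
    (d.factorial : ZMod (p ^ (r + 1))) *
        ((p ^ r * (p - 1) * (m + 1) + c).stirlingSecond d : ZMod (p ^ (r + 1))) =
      (factorialMulPartialStirling p c d : ZMod (p ^ (r + 1))) := by
  have h := congrArg (Int.cast : ℤ → ZMod (p ^ (r + 1)))
    (sum_choose_pow_eq_factorial_mul_stirlingSecond (p ^ r * (p - 1) * (m + 1) + c) d)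
  push_cast at h
  rw [← h, factorialMulPartialStirling, Int.cast_sum]
  refine sum_congr rfl fun i _ => ?_
  have hi := natCast_pow_zmod_prime_pow p r m c i
  rw [hi]
  split_ifs <;> simp

theorem factorial_mul_stirlingSecond_zmod_eq_choose (p r s b g c : ℕ) [hp : Fact p.Prime]
    (hrs : r ≤ s) (hg : 0 < g) :
    ((c + 1).factorial : ZMod (p ^ (r + 1))) *
        ((p ^ (r + 1 + s) * (b + (p - 1) * g) + c).stirlingSecond
          (p ^ (r + 1 + s) * b + (c + 1)) : ZMod (p ^ (r + 1))) =
      (factorialMulPartialStirling p c (c + 1) : ZMod (p ^ (r + 1))) *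
        ((p ^ s * (b + p * g) - 1).choose (p ^ s * b) : ZMod (p ^ (r + 1))) := by
  set R := ZMod (p ^ (r + 1))
  set k := p ^ (r + 1 + s) * b + (c + 1) with hk
  set G : ℕ → PowerSeries R := fun k => PowerSeries.mk fun n => ((n + k).stirlingSecond k : R)
    with hG
  have hq : 0 < p ^ r * (p - 1) :=
    Nat.mul_pos (pow_pos hp.out.pos _) (Nat.sub_pos_of_lt hp.out.one_lt)
  have hGk : G k * (1 - PowerSeries.X ^ (p ^ r * (p - 1))) ^ (p ^ s * b) = G (c + 1) := by
    have h1 := mk_stirlingSecond_mul_prodOneSubMulX R k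
    have h2 := mk_stirlingSecond_mul_prodOneSubMulX R (c + 1)
    rw [prodOneSubMulX_zmod_prime_pow p r s b (c + 1) hrs] at h1
    simp only [Polynomial.coe_mul, Polynomial.coe_pow, Polynomial.coe_sub, Polynomial.coe_one,
      Polynomial.coe_X] at h1
    linear_combination (-G k * (1 - PowerSeries.X ^ (p ^ r * (p - 1))) ^ (p ^ s * b)) * h2 +
      G (c + 1) * h1
  obtain ⟨m, hm⟩ : ∃ m, p ^ (s + 1) * g = m + 1 :=
    Nat.exists_eq_add_one.2 (Nat.mul_pos (pow_pos hp.out.pos _) hg)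
  have key := coeff_eq_choose_of_mul_one_sub_X_pow hq
    (factorialMulPartialStirling p c (c + 1) : R) (p ^ s * b)
    (PowerSeries.C ((c + 1).factorial : R) * G k) (PowerSeries.C ((c + 1).factorial : R) * G (c + 1))
    (by rw [mul_assoc, hGk]) (fun m => by
      have hpos : 0 < p ^ r * (p - 1) * (m + 1) := Nat.mul_pos hq m.succ_pos
      rw [PowerSeries.coeff_C_mul, hG, PowerSeries.coeff_mk,
        show p ^ r * (p - 1) * (m + 1) - 1 + (c + 1) = p ^ r * (p - 1) * (m + 1) + c by omega]
      exact factorial_mul_stirlingSecond_zmod p r m c (c + 1)) m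
  rw [PowerSeries.coeff_C_mul, hG, PowerSeries.coeff_mk] at key
  have hpos : 0 < p ^ r * (p - 1) * (m + 1) := Nat.mul_pos hq m.succ_pos
  have hn : p ^ r * (p - 1) * (m + 1) - 1 + k = p ^ (r + 1 + s) * (b + (p - 1) * g) + c := by
    have : p ^ r * (p - 1) * (m + 1) = p ^ (r + 1 + s) * ((p - 1) * g) := by rw [← hm]; ring
    rw [mul_add (p ^ (r + 1 + s))]
    omega
  have hB : p ^ s * b + m = p ^ s * (b + p * g) - 1 := by
    have : p ^ s * (p * g) = m + 1 := by rw [← hm]; ring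
    rw [mul_add]
    omega
  rw [hn, hB] at key
  exact key

theorem prime_pow_dvd_choose_sub_choose (p e n k : ℕ) [hp : Fact p.Prime] :
    (p : ℤ) ^ (e + 1) ∣ ((p ^ (e + 1) * n).choose (p ^ (e + 1) * k) : ℤ) -
      ((p ^ e * n).choose (p ^ e * k) : ℤ) := by
  have hdvd : (p : Polynomial ℤ) ∣ (1 + Polynomial.X) ^ p - Polynomial.expand ℤ p (1 + Polynomial.X) := by
    rw [← map_natCast Polynomial.C, Polynomial.C_dvd_iff_dvd_coeff]
    intro i
    rw [← ZMod.intCast_zmod_eq_zero_iff_dvd,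
      ← eq_intCast (Int.castRingHom (ZMod p)), ← Polynomial.coeff_map]
    simp [add_pow_char]
  have hpow := (dvd_sub_pow_of_dvd_sub hdvd e).trans (sub_dvd_pow_sub_pow _ _ n)
  rw [← Nat.cast_pow, ← map_natCast Polynomial.C, Polynomial.C_dvd_iff_dvd_coeff] at hpow
  have h := hpow (p ^ e * k * p)
  rw [← pow_mul, ← pow_mul, ← pow_mul, ← map_pow, Polynomial.coeff_sub,
    Polynomial.coeff_expand_mul hp.out.pos, Polynomial.coeff_one_add_X_pow,
    Polynomial.coeff_one_add_X_pow] at h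
  rw [show p * (p ^ e * n) = p ^ (e + 1) * n by ring, show p ^ e * k * p = p ^ (e + 1) * k by ring,
    Nat.cast_pow] at h
  exact h

end

section

open Filter Topology

theorem PadicInt.norm_intCast_sub_le_of_zmod_eq {p : ℕ} [Fact p.Prime] {r : ℕ} {x y : ℤ}
    (h : (x : ZMod (p ^ r)) = (y : ZMod (p ^ r))) :
    ‖((x : ℤ_[p]) - (y : ℤ_[p]))‖ ≤ ((p : ℝ)⁻¹) ^ r := by
  rw [← Int.cast_sub, inv_pow, ← zpow_natCast, ← zpow_neg, PadicInt.norm_int_le_pow_iff_dvd,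
    ← Nat.cast_pow, ← ZMod.intCast_zmod_eq_zero_iff_dvd, Int.cast_sub, h, sub_self]

theorem PadicInt.exists_tendsto_of_tendsto_mul {p : ℕ} [Fact p.Prime] {m : ℤ_[p]} (hm : m ≠ 0)
    {z : ℕ → ℤ_[p]} {Y : ℤ_[p]} (h : Tendsto (fun e => m * z e) atTop (𝓝 Y)) :
    ∃ L, Tendsto z atTop (𝓝 L) ∧ m * L = Y := by
  have hm' : (m : ℚ_[p]) ≠ 0 := by simpa using hm
  have hc : Tendsto (fun e => (z e : ℚ_[p])) atTop (𝓝 ((m : ℚ_[p])⁻¹ * Y)) := by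
    have h1 := ((continuous_subtype_val.tendsto Y).comp h).const_mul (m : ℚ_[p])⁻¹
    refine h1.congr fun e => ?_
    exact inv_mul_cancel_left₀ hm' _
  have hle : ‖(m : ℚ_[p])⁻¹ * Y‖ ≤ 1 :=
    le_of_tendsto hc.norm (Eventually.of_forall fun e => (z e).2)
  refine ⟨⟨_, hle⟩, tendsto_subtype_rng.2 hc, Subtype.ext ?_⟩
  exact mul_inv_cancel_left₀ hm' _

theorem PadicInt.exists_tendsto_choose_prime_pow_mul (p n k : ℕ) [hp : Fact p.Prime] :
    ∃ X : ℤ_[p], Tendsto (fun e => ((p ^ e * n).choose (p ^ e * k) : ℤ_[p])) atTop (𝓝 X) := by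
  refine cauchySeq_tendsto_of_complete (cauchySeq_of_le_geometric (p : ℝ)⁻¹ 1
    (inv_lt_one_of_one_lt₀ (by exact_mod_cast hp.out.one_lt)) fun e => ?_)
  rw [dist_comm, dist_eq_norm, one_mul]
  have h := PadicInt.norm_intCast_sub_le_of_zmod_eq (p := p) (r := e)
    (x := ((p ^ (e + 1) * n).choose (p ^ (e + 1) * k) : ℕ))
    (y := ((p ^ e * n).choose (p ^ e * k) : ℕ)) (by
      rw [← sub_eq_zero, ← Int.cast_sub, ZMod.intCast_zmod_eq_zero_iff_dvd, Nat.cast_pow]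
      exact (pow_dvd_pow _ e.le_succ).trans (prime_pow_dvd_choose_sub_choose p e n k))
  simpa using h

theorem PadicInt.exists_tendsto_choose_prime_pow_mul_sub_one (p n k : ℕ) [hp : Fact p.Prime]
    (hn : 0 < n) :
    ∃ M : ℤ_[p], Tendsto (fun e => ((p ^ e * n - 1).choose (p ^ e * k) : ℤ_[p])) atTop (𝓝 M) := by
  obtain ⟨X, hX⟩ := exists_tendsto_choose_prime_pow_mul p n k
  have hn' : (n : ℤ_[p]) ≠ 0 := by exact_mod_cast hn.ne'
  have key (e : ℕ) : ((n - k : ℕ) : ℤ_[p]) * ((p ^ e * n).choose (p ^ e * k) : ℤ_[p]) =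
      n * ((p ^ e * n - 1).choose (p ^ e * k) : ℤ_[p]) := by
    have hpe : 0 < p ^ e := pow_pos hp.out.pos e
    obtain ⟨N, hN⟩ : ∃ N, p ^ e * n = N + 1 := Nat.exists_eq_add_one.2 (Nat.mul_pos hpe hn)
    have h := Nat.choose_mul_succ_eq N (p ^ e * k)
    rw [← hN, ← Nat.mul_sub] at h
    have h2 : p ^ e * (n * (p ^ e * n - 1).choose (p ^ e * k)) =
        p ^ e * ((n - k) * (p ^ e * n).choose (p ^ e * k)) := by
      rw [show p ^ e * n - 1 = N by omega]
      linarith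
    exact_mod_cast (Nat.eq_of_mul_eq_mul_left hpe h2).symm
  obtain ⟨M, hM, -⟩ := exists_tendsto_of_tendsto_mul hn' ((hX.const_mul _).congr key)
  exact ⟨M, hM⟩

theorem tendsto_factorial_mul_stirlingSecond (p b g c : ℕ) [hp : Fact p.Prime] (hg : 0 < g)
    {M : ℤ_[p]}
    (hM : Tendsto (fun e => ((p ^ e * (b + p * g) - 1).choose (p ^ e * b) : ℤ_[p])) atTop (𝓝 M)) :
    Tendsto (fun e => ((c + 1).factorial : ℤ_[p]) *
      ((p ^ e * (b + (p - 1) * g) + c).stirlingSecond (p ^ e * b + (c + 1)) : ℤ_[p])) atTop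
      (𝓝 ((factorialMulPartialStirling p c (c + 1) : ℤ_[p]) * M)) := by
  have hdiv : Tendsto (fun e : ℕ => e / 2) atTop atTop :=
    Nat.tendsto_div_const_atTop two_ne_zero
  have hsub : Tendsto (fun e : ℕ => e - e / 2) atTop atTop :=
    tendsto_atTop_mono (fun e => by omega) hdiv
  have h1 := (hM.comp hsub).const_mul (factorialMulPartialStirling p c (c + 1) : ℤ_[p])
  refine h1.congr_dist ?_
  refine squeeze_zero' (Eventually.of_forall fun _ => dist_nonneg) ?_
    ((tendsto_pow_atTop_nhds_zero_of_lt_one (r := (p : ℝ)⁻¹) (by positivity)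
    (inv_lt_one_of_one_lt₀ (by exact_mod_cast hp.out.one_lt))).comp hdiv)
  filter_upwards [eventually_ge_atTop 2] with e he
  obtain ⟨r, hr⟩ : ∃ r, e / 2 = r + 1 := Nat.exists_eq_add_one.2 (by omega)
  obtain ⟨s, rfl⟩ : ∃ s, e = r + 1 + s := ⟨e - e / 2, by omega⟩
  have hs : r + 1 + s - (r + 1) = s := Nat.add_sub_cancel_left _ _
  have h := factorial_mul_stirlingSecond_zmod_eq_choose p r s b g c (by omega) hg
  have h' := PadicInt.norm_intCast_sub_le_of_zmod_eq (p := p) (r := r + 1)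
    (x := ((c + 1).factorial * (p ^ (r + 1 + s) * (b + (p - 1) * g) + c).stirlingSecond
      (p ^ (r + 1 + s) * b + (c + 1)) : ℕ))
    (y := factorialMulPartialStirling p c (c + 1) *
      ((p ^ s * (b + p * g) - 1).choose (p ^ s * b) : ℕ)) (by push_cast at h ⊢; exact h)
  rw [dist_comm, dist_eq_norm]
  simp only [Function.comp_apply, hr, hs]
  simpa using h'

end

theorem padic_limit_stirling2_d_minus_one (p : ℕ) [Fact p.Prime] (a b α d : ℤ)
    (hb : 1 ≤ b) (hba : b ≤ a) (hab : Int.ModEq ((p : ℤ) - 1) a b)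
    (hα : α * ((p : ℤ) - 1) = (p : ℤ) * a - b) (hd : 1 ≤ d) :
    ∃ L M : ℤ_[p],
      Filter.Tendsto
        (fun e : ℕ =>
          ((stirling2 ((p : ℤ) ^ e * a + d - 1) ((p : ℤ) ^ e * b + d) : ℤ) : ℤ_[p]))
        Filter.atTop (nhds L) ∧
      Filter.Tendsto
        (fun e : ℕ => ((ichoose ((p : ℤ) ^ e * α - 1) ((p : ℤ) ^ e * b) : ℤ) : ℤ_[p]))
        Filter.atTop (nhds M) ∧
      (L : ℚ_[p]) = ((partialStirling p (d - 1).toNat d.toNat : ℚ) : ℚ_[p]) * (M : ℚ_[p]) := by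
  have hp := (Fact.out : p.Prime)
  have hp1 : (1 : ℤ) < p := by exact_mod_cast hp.one_lt
  lift b to ℕ using by omega
  obtain ⟨c, rfl⟩ : ∃ c : ℕ, d = c + 1 := ⟨(d - 1).toNat, by omega⟩
  obtain ⟨g, hg⟩ : ((p : ℤ) - 1) ∣ a - b := hab.symm.dvd
  have hg0 : 0 ≤ g := nonneg_of_mul_nonneg_right (a := (p : ℤ) - 1) (by omega) (by omega)
  lift g to ℕ using hg0
  obtain rfl : a = (b + (p - 1) * g : ℕ) := by
    rw [Nat.cast_add, Nat.cast_mul, Nat.cast_pred hp.pos]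
    linarith
  obtain rfl : α = (b + p * g : ℕ) := by
    rw [Nat.cast_add, Nat.cast_mul, Nat.cast_pred hp.pos] at hα
    refine mul_right_cancel₀ (b := (p : ℤ) - 1) (by omega) ?_
    rw [hα]
    push_cast
    ring
  have hb' : 0 < b := by omega
  have hS (e : ℕ) : stirling2 ((p : ℤ) ^ e * ((b + (p - 1) * g : ℕ) : ℤ) + (c + 1) - 1)
      ((p : ℤ) ^ e * b + (c + 1)) =
      ((p ^ e * (b + (p - 1) * g) + c).stirlingSecond (p ^ e * b + (c + 1)) : ℤ) := by
    rw [← stirling2_natCast]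
    congr 1
    push_cast
    ring
  have hC (e : ℕ) : ichoose ((p : ℤ) ^ e * ((b + p * g : ℕ) : ℤ) - 1) ((p : ℤ) ^ e * b) =
      ((p ^ e * (b + p * g) - 1).choose (p ^ e * b) : ℤ) := by
    have h : 0 < p ^ e * (b + p * g) := Nat.mul_pos (pow_pos hp.pos e) (by omega)
    rw [ichoose, ← Nat.cast_pow, ← Nat.cast_mul, ← Nat.cast_mul, ← Nat.cast_pred h,
      Int.toNat_natCast, Int.toNat_natCast]
  have hd1 : (((c : ℤ) + 1) - 1).toNat = c := by omega
  have hd2 : ((c : ℤ) + 1).toNat = c + 1 := by omega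
  simp only [hS, hC, hd1, hd2, Int.cast_natCast]
  rcases Nat.eq_zero_or_pos g with rfl | hg
  · refine ⟨0, 0, tendsto_const_nhds.congr fun e => ?_, tendsto_const_nhds.congr fun e => ?_, ?_⟩
    · rw [Nat.stirlingSecond_eq_zero_of_lt (by simp), Nat.cast_zero]
    · have h : 0 < p ^ e * b := Nat.mul_pos (pow_pos hp.pos e) hb'
      rw [mul_zero, add_zero, Nat.choose_eq_zero_of_lt (by omega), Nat.cast_zero]
    · simp
  · obtain ⟨M, hM⟩ := PadicInt.exists_tendsto_choose_prime_pow_mul_sub_one p (b + p * g) b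
      (by omega)
    have hfac : ((c + 1).factorial : ℤ_[p]) ≠ 0 := by exact_mod_cast (c + 1).factorial_ne_zero
    obtain ⟨L, hL, hLM⟩ := PadicInt.exists_tendsto_of_tendsto_mul hfac
      (tendsto_factorial_mul_stirlingSecond p b g c hg hM)
    refine ⟨L, M, hL, hM, ?_⟩
    have hfac' : ((c + 1).factorial : ℚ_[p]) ≠ 0 := by exact_mod_cast (c + 1).factorial_ne_zero
    have hLM' := congrArg (Subtype.val : ℤ_[p] → ℚ_[p]) hLM
    simp only [PadicInt.coe_mul, PadicInt.coe_natCast, PadicInt.coe_intCast] at hLM'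
    rw [partialStirling_eq_div]
    push_cast
    rw [div_mul_eq_mul_div, eq_div_iff hfac', mul_comm, hLM']
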